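/- (Interior eigenvalue bound.) Let λ_α be an eigenvalue of A with Λ ≠ λ_α, and let j be an index with λ'_j = −(λ_α − Λ)². Assume: K(A',v,n) has dimension n; ⟨z'_j, v⟩ ≠ 0; λ'_{j+1} > λ'_N; and θ'_i > λ'_j for every i < j, where θ'_1 ≥ … ≥ θ'_n are the Ritz values of A' from K(A',v,n). Set θ̄_α = Λ + sgn(λ_α − Λ)·√(−θ'_j). Then |λ_α − θ̄_α| ≤ (λ'_j − λ'_N)·(K'_j·tan∠'_j)² / (2·|λ_α − Λ|·T_{n−j}(γ'_j(λ'_j))²). -/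

import Mathlib

open Matrix Polynomial

/-- The Krylov subspace `K(B,v,n) = span(v, Bv, …, B^{n-1}v)`. -/
noncomputable def Krylov {N : ℕ} (B : Matrix (Fin N) (Fin N) ℂ) (v : Fin N → ℂ) (n : ℕ) :
    Submodule ℂ (Fin N → ℂ) :=
  Submodule.span ℂ {w | ∃ k < n, w = (B ^ k).mulVec v}

section OrthonormalEigenbasis

variable {ι : Type*} [Fintype ι] [DecidableEq ι] {f : ι → ι → ℂ}

/-- Expansion of a vector in an orthonormal basis of `ι → ℂ`. -/
theorem sum_dotProduct_smul_eq_of_orthonormal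
    (hf : ∀ i k, star (f i) ⬝ᵥ f k = if i = k then 1 else 0) (x : ι → ℂ) :
    ∑ k, (star (f k) ⬝ᵥ x) • f k = x := by
  have h1 : (Matrix.of fun i => star (f i)) * (Matrix.of f)ᵀ = 1 := by
    ext i k
    simpa [Matrix.mul_apply, Matrix.one_apply, dotProduct] using hf i k
  have h2 := congrArg (fun M => M *ᵥ x) (mul_eq_one_comm.mp h1)
  simp only [one_mulVec, ← mulVec_mulVec] at h2
  conv_rhs => rw [← h2]
  ext i
  simp [Matrix.mulVec, dotProduct, mul_comm]

theorem star_dotProduct_self_eq_sum_norm_sq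
    (hf : ∀ i k, star (f i) ⬝ᵥ f k = if i = k then 1 else 0) (x : ι → ℂ) :
    star x ⬝ᵥ x = ((∑ k, ‖star (f k) ⬝ᵥ x‖ ^ 2 : ℝ) : ℂ) := by
  conv_lhs => rw [← sum_dotProduct_smul_eq_of_orthonormal hf x, star_sum]
  rw [sum_dotProduct_smul_eq_of_orthonormal hf x, sum_dotProduct]
  push_cast
  refine Finset.sum_congr rfl fun k _ => ?_
  rw [star_smul, smul_dotProduct, ← Complex.conj_mul']
  rfl

theorem star_dotProduct_mulVec_of_orthonormal
    (hf : ∀ i k, star (f i) ⬝ᵥ f k = if i = k then 1 else 0)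
    {B : Matrix ι ι ℂ} {μ : ι → ℝ} (hB : ∀ i, B *ᵥ f i = (μ i : ℂ) • f i) (k : ι) (x : ι → ℂ) :
    star (f k) ⬝ᵥ B *ᵥ x = μ k * (star (f k) ⬝ᵥ x) := by
  conv_lhs => rw [← sum_dotProduct_smul_eq_of_orthonormal hf x]
  simp [mulVec_sum, mulVec_smul, hB, dotProduct_sum, hf, mul_comm]

theorem star_dotProduct_mulVec_eq_sum
    (hf : ∀ i k, star (f i) ⬝ᵥ f k = if i = k then 1 else 0)
    {B : Matrix ι ι ℂ} {μ : ι → ℝ} (hB : ∀ i, B *ᵥ f i = (μ i : ℂ) • f i) (x : ι → ℂ) :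
    star x ⬝ᵥ B *ᵥ x = ((∑ k, μ k * ‖star (f k) ⬝ᵥ x‖ ^ 2 : ℝ) : ℂ) := by
  conv_lhs => rw [← sum_dotProduct_smul_eq_of_orthonormal hf x, star_sum]
  rw [sum_dotProduct_smul_eq_of_orthonormal hf x, sum_dotProduct]
  push_cast
  refine Finset.sum_congr rfl fun k _ => ?_
  rw [star_smul, smul_dotProduct, star_dotProduct_mulVec_of_orthonormal hf hB,
    ← Complex.conj_mul', smul_eq_mul]
  exact mul_left_comm _ _ _

theorem star_dotProduct_aeval_mulVec
    (hf : ∀ i k, star (f i) ⬝ᵥ f k = if i = k then 1 else 0)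
    {B : Matrix ι ι ℂ} {μ : ι → ℝ} (hB : ∀ i, B *ᵥ f i = (μ i : ℂ) • f i)
    (p : ℝ[X]) (k : ι) (x : ι → ℂ) :
    star (f k) ⬝ᵥ (aeval B p) *ᵥ x = (p.eval (μ k) : ℝ) * (star (f k) ⬝ᵥ x) := by
  induction p using Polynomial.induction_on' generalizing x with
  | add p q hp hq => simp [add_mulVec, hp, hq, add_mul]
  | monomial d a =>
    have hpow : ∀ (d : ℕ) (x : ι → ℂ),
        star (f k) ⬝ᵥ (B ^ d) *ᵥ x = (μ k : ℂ) ^ d * (star (f k) ⬝ᵥ x) := by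
      intro d
      induction d with
      | zero => simp
      | succ d ih =>
        intro x
        rw [pow_succ, ← mulVec_mulVec, ih, star_dotProduct_mulVec_of_orthonormal hf hB]
        ring
    simp [aeval_monomial, ← Algebra.smul_def, smul_mulVec, hpow,
      mul_assoc]

end OrthonormalEigenbasis

theorem aeval_mulVec_mem_Krylov {N : ℕ} (B : Matrix (Fin N) (Fin N) ℂ) (v : Fin N → ℂ) {n : ℕ}
    {p : ℝ[X]} (hp : p.natDegree < n) : (aeval B p) *ᵥ v ∈ Krylov B v n := by
  rw [aeval_eq_sum_range' hp, sum_mulVec]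
  refine Submodule.sum_mem _ fun k hk => ?_
  rw [smul_mulVec, ← Complex.coe_smul]
  exact Submodule.smul_mem _ _ (Submodule.subset_span ⟨k, Finset.mem_range.mp hk, rfl⟩)

section RayleighRitz

variable {N n : ℕ} {B : Matrix (Fin N) (Fin N) ℂ} {μ : Fin N → ℝ} {f : Fin N → Fin N → ℂ}
  {Q : Matrix (Fin N) (Fin n) ℂ} {θ : Fin n → ℝ} {s : Fin n → Fin n → ℂ}

theorem star_mulVec_dotProduct_mulVec_of_conjTranspose_mul_self (hQ : Qᴴ * Q = 1)
    (x : Fin n → ℂ) : star (Q *ᵥ x) ⬝ᵥ (Q *ᵥ x) = star x ⬝ᵥ x := by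
  rw [star_mulVec, ← dotProduct_mulVec, mulVec_mulVec, hQ, one_mulVec]

theorem star_mulVec_dotProduct_mulVec_mulVec (x y : Fin n → ℂ) :
    star (Q *ᵥ x) ⬝ᵥ B *ᵥ (Q *ᵥ y) = star x ⬝ᵥ (Qᴴ * B * Q) *ᵥ y := by
  rw [star_mulVec, ← dotProduct_mulVec, mulVec_mulVec, mulVec_mulVec, Matrix.mul_assoc]

theorem sum_norm_sq_mulVec (hf : ∀ i k, star (f i) ⬝ᵥ f k = if i = k then 1 else 0)
    (hQ : Qᴴ * Q = 1) (hs : ∀ i k, star (s i) ⬝ᵥ s k = if i = k then 1 else 0) (x : Fin n → ℂ) :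
    ∑ k, ‖star (f k) ⬝ᵥ Q *ᵥ x‖ ^ 2 = ∑ i, ‖star (s i) ⬝ᵥ x‖ ^ 2 := by
  have h := star_mulVec_dotProduct_mulVec_of_conjTranspose_mul_self hQ x
  rw [star_dotProduct_self_eq_sum_norm_sq hf, star_dotProduct_self_eq_sum_norm_sq hs] at h
  exact_mod_cast h

theorem sum_mul_norm_sq_mulVec (hf : ∀ i k, star (f i) ⬝ᵥ f k = if i = k then 1 else 0)
    (hB : ∀ i, B *ᵥ f i = (μ i : ℂ) • f i)
    (hs : ∀ i k, star (s i) ⬝ᵥ s k = if i = k then 1 else 0)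
    (hθ : ∀ i, (Qᴴ * B * Q) *ᵥ s i = (θ i : ℂ) • s i) (x : Fin n → ℂ) :
    ∑ k, μ k * ‖star (f k) ⬝ᵥ Q *ᵥ x‖ ^ 2 = ∑ i, θ i * ‖star (s i) ⬝ᵥ x‖ ^ 2 := by
  have h := star_mulVec_dotProduct_mulVec_mulVec (B := B) (Q := Q) x x
  rw [star_dotProduct_mulVec_eq_sum hf hB, star_dotProduct_mulVec_eq_sum hs hθ] at h
  exact_mod_cast h

/-- Cauchy interlacing: a Ritz value is at most the eigenvalue of the same index. -/
theorem ritzValue_le_eigenvalue (hμ : Antitone μ)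
    (hf : ∀ i k, star (f i) ⬝ᵥ f k = if i = k then 1 else 0)
    (hB : ∀ i, B *ᵥ f i = (μ i : ℂ) • f i) (hnN : n ≤ N) (hQ : Qᴴ * Q = 1)
    (hθanti : Antitone θ) (hs : ∀ i k, star (s i) ⬝ᵥ s k = if i = k then 1 else 0)
    (hθ : ∀ i, (Qᴴ * B * Q) *ᵥ s i = (θ i : ℂ) • s i) (j : Fin n) :
    θ j ≤ μ (Fin.castLE hnN j) := by
  let M : Matrix {i : Fin n // i ≠ j} (Fin n) ℂ := fun i =>
    if i.1 < j then star (f (Fin.castLE hnN i.1)) ᵥ* Q else star (s i.1)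
  have hker : LinearMap.ker M.mulVecLin ≠ ⊥ := by
    apply LinearMap.ker_ne_bot_of_finrank_lt
    have := j.pos
    simp only [Module.finrank_fintype_fun_eq_card, Fintype.card_subtype_compl, Fintype.card_fin,
      Fintype.card_unique]
    omega
  obtain ⟨x, hx, hx0⟩ := Submodule.exists_mem_ne_zero_of_ne_bot hker
  have hM : ∀ i : {i : Fin n // i ≠ j}, M i ⬝ᵥ x = 0 := fun i =>
    congrFun (LinearMap.mem_ker.mp hx) i
  have hgt : ∀ i, j < i → star (s i) ⬝ᵥ x = 0 := fun i hi => by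
    simpa [M, hi.not_gt] using hM ⟨i, hi.ne'⟩
  have hlt : ∀ k : Fin N, (k : ℕ) < j → star (f k) ⬝ᵥ Q *ᵥ x = 0 := fun k hk => by
    have hi : (⟨k, hk.trans j.2⟩ : Fin n) < j := hk
    have h := hM ⟨_, hi.ne⟩
    simp only [M, hi, if_true, ← dotProduct_mulVec] at h
    exact h
  have hpos : 0 < ∑ i, ‖star (s i) ⬝ᵥ x‖ ^ 2 := by
    refine (Finset.sum_nonneg fun i _ => by positivity).lt_of_ne fun h0 => hx0 ?_
    have h := (Finset.sum_eq_zero_iff_of_nonneg fun i _ => sq_nonneg _).mp h0.symm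
    rw [← sum_dotProduct_smul_eq_of_orthonormal hs x]
    refine Finset.sum_eq_zero fun i hi => ?_
    rw [norm_eq_zero.mp (pow_eq_zero_iff two_ne_zero |>.mp (h i hi)), zero_smul]
  refine le_of_mul_le_mul_right ?_ hpos
  calc θ j * ∑ i, ‖star (s i) ⬝ᵥ x‖ ^ 2 ≤ ∑ i, θ i * ‖star (s i) ⬝ᵥ x‖ ^ 2 := by
        rw [Finset.mul_sum]
        refine Finset.sum_le_sum fun i _ => ?_
        rcases le_or_gt i j with hi | hi
        · exact mul_le_mul_of_nonneg_right (hθanti hi) (by positivity)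
        · simp [hgt i hi]
    _ = ∑ k, μ k * ‖star (f k) ⬝ᵥ Q *ᵥ x‖ ^ 2 := (sum_mul_norm_sq_mulVec hf hB hs hθ x).symm
    _ ≤ μ (Fin.castLE hnN j) * ∑ k, ‖star (f k) ⬝ᵥ Q *ᵥ x‖ ^ 2 := by
        rw [Finset.mul_sum]
        refine Finset.sum_le_sum fun k _ => ?_
        rcases lt_or_ge (k : ℕ) j with hk | hk
        · simp [hlt k hk]
        · exact mul_le_mul_of_nonneg_right (hμ (by exact hk)) (by positivity)
    _ = _ := by rw [sum_norm_sq_mulVec hf hQ hs]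

/-- A vector `(B - θ i) w` with `w` in the trial space has no component along the `i`-th Ritz
vector. -/
theorem star_ritzVector_dotProduct_eq_zero (hQ : Qᴴ * Q = 1)
    (hs : ∀ i k, star (s i) ⬝ᵥ s k = if i = k then 1 else 0)
    (hθ : ∀ i, (Qᴴ * B * Q) *ᵥ s i = (θ i : ℂ) • s i) {x y : Fin n → ℂ} {i : Fin n}
    (h : Q *ᵥ x = B *ᵥ (Q *ᵥ y) - (θ i : ℂ) • (Q *ᵥ y)) : star (s i) ⬝ᵥ x = 0 := by
  have hx : x = (Qᴴ * B * Q) *ᵥ y - (θ i : ℂ) • y := by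
    have h' := congrArg (fun w => Qᴴ *ᵥ w) h
    simpa [mulVec_sub, mulVec_smul, mulVec_mulVec, ← Matrix.mul_assoc, hQ] using h'
  rw [hx, dotProduct_sub, star_dotProduct_mulVec_of_orthonormal hs hθ, dotProduct_smul,
    smul_eq_mul, sub_self]

/-- The variational bound behind the Kaniel–Paige–Saad estimates. -/
theorem eigenvalue_sub_ritzValue_mul_le {v : Fin N → ℂ} (hμ : Antitone μ)
    (hf : ∀ i k, star (f i) ⬝ᵥ f k = if i = k then 1 else 0)
    (hB : ∀ i, B *ᵥ f i = (μ i : ℂ) • f i) (hnN : n ≤ N) (hQ : Qᴴ * Q = 1)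
    (hQX : LinearMap.range Q.mulVecLin = Krylov B v n)
    (hθanti : Antitone θ) (hs : ∀ i k, star (s i) ⬝ᵥ s k = if i = k then 1 else 0)
    (hθ : ∀ i, (Qᴴ * B * Q) *ᵥ s i = (θ i : ℂ) • s i) (j : Fin n)
    {p : ℝ[X]} (hp0 : p ≠ 0) (hp : p.natDegree < n) (hroot : ∀ i < j, p.IsRoot (θ i)) :
    (μ (Fin.castLE hnN j) - θ j) *
        (p.eval (μ (Fin.castLE hnN j)) ^ 2 * ‖star (f (Fin.castLE hnN j)) ⬝ᵥ v‖ ^ 2) ≤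
      ∑ k with (j : ℕ) < (k : Fin N).val, (μ (Fin.castLE hnN j) - μ k) *
        (p.eval (μ k) ^ 2 * ‖star (f k) ⬝ᵥ v‖ ^ 2) := by
  have hmem : ∀ q : ℝ[X], q.natDegree < n → ∃ x, Q *ᵥ x = (aeval B q) *ᵥ v := fun q hq => by
    have h := aeval_mulVec_mem_Krylov B v hq
    rw [← hQX] at h
    exact h
  obtain ⟨x, hx⟩ := hmem p hp
  have hlt : ∀ i < j, star (s i) ⬝ᵥ x = 0 := fun i hi => by
    obtain ⟨r, hr⟩ := dvd_iff_isRoot.mpr (hroot i hi)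
    obtain ⟨y, hy⟩ := hmem r
      ((natDegree_le_of_dvd (Dvd.intro_left _ hr.symm) hp0).trans_lt hp)
    refine star_ritzVector_dotProduct_eq_zero hQ hs hθ (y := y) ?_
    rw [hx, hy, hr, map_mul, map_sub, aeval_X, aeval_C, sub_mul, sub_mulVec, ← mulVec_mulVec,
      ← Algebra.smul_def, smul_mulVec, Complex.coe_smul]
  have hnorm : ∀ k, ‖star (f k) ⬝ᵥ Q *ᵥ x‖ ^ 2 = p.eval (μ k) ^ 2 * ‖star (f k) ⬝ᵥ v‖ ^ 2 :=
    fun k => by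
      rw [hx, star_dotProduct_aeval_mulVec hf hB, norm_mul, mul_pow, Complex.norm_real,
        Real.norm_eq_abs, sq_abs]
  have hray : ∑ k, μ k * ‖star (f k) ⬝ᵥ Q *ᵥ x‖ ^ 2 ≤
      θ j * ∑ k, ‖star (f k) ⬝ᵥ Q *ᵥ x‖ ^ 2 := by
    rw [sum_mul_norm_sq_mulVec hf hB hs hθ, sum_norm_sq_mulVec hf hQ hs, Finset.mul_sum]
    refine Finset.sum_le_sum fun i _ => ?_
    rcases lt_or_ge i j with hi | hi
    · simp [hlt i hi]
    · exact mul_le_mul_of_nonneg_right (hθanti hi) (by positivity)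
  have hle := ritzValue_le_eigenvalue hμ hf hB hnN hQ hθanti hs hθ j
  simp only [← hnorm]
  set J := Fin.castLE hnN j
  calc (μ J - θ j) * ‖star (f J) ⬝ᵥ Q *ᵥ x‖ ^ 2
      ≤ (μ J - θ j) * ∑ k, ‖star (f k) ⬝ᵥ Q *ᵥ x‖ ^ 2 :=
        mul_le_mul_of_nonneg_left
          (Finset.single_le_sum (f := fun k => ‖star (f k) ⬝ᵥ Q *ᵥ x‖ ^ 2)
            (fun k _ => by positivity) (Finset.mem_univ J)) (sub_nonneg.mpr hle)
    _ ≤ ∑ k, (μ J - μ k) * ‖star (f k) ⬝ᵥ Q *ᵥ x‖ ^ 2 := by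
        simp only [sub_mul, Finset.sum_sub_distrib, ← Finset.mul_sum]
        linarith
    _ ≤ _ := by
        rw [Finset.sum_filter]
        refine Finset.sum_le_sum fun k _ => ?_
        split_ifs with hk
        · exact le_rfl
        · exact mul_nonpos_of_nonpos_of_nonneg
            (sub_nonpos.mpr (hμ (by exact not_lt.mp hk))) (by positivity)

/-- The Kaniel–Paige–Saad bound for the Ritz values from a Krylov subspace. -/
theorem eigenvalue_sub_ritzValue_le {v : Fin N → ℂ} (hμ : Antitone μ)
    (hf : ∀ i k, star (f i) ⬝ᵥ f k = if i = k then 1 else 0)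
    (hB : ∀ i, B *ᵥ f i = (μ i : ℂ) • f i) (hnN : n ≤ N) (hQ : Qᴴ * Q = 1)
    (hQX : LinearMap.range Q.mulVecLin = Krylov B v n)
    (hθanti : Antitone θ) (hs : ∀ i k, star (s i) ⬝ᵥ s k = if i = k then 1 else 0)
    (hθ : ∀ i, (Qᴴ * B * Q) *ᵥ s i = (θ i : ℂ) • s i) (j : Fin n)
    {a b c : ℝ} (ha : a = μ (Fin.castLE hnN j)) (hba : b ≤ a) (hcb : c < b)
    (hb : ∀ k : Fin N, (j : ℕ) < k → μ k ≤ b) (hc : ∀ k, c ≤ μ k)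
    (hv : star (f (Fin.castLE hnN j)) ⬝ᵥ v ≠ 0) (hθa : ∀ i : Fin n, (i : ℕ) < j → a < θ i) :
    a - θ j ≤ (a - c) * ((∏ i with (i : Fin n).val < j.val, (θ i - c) / (θ i - a)) ^ 2 *
        ((∑ k with j.val < (k : Fin N).val, ‖star (f k) ⬝ᵥ v‖ ^ 2) /
          ‖star (f (Fin.castLE hnN j)) ⬝ᵥ v‖ ^ 2)) /
      (Chebyshev.T ℝ ((n : ℤ) - (j : ℕ) - 1)).eval (1 + 2 * (a - b) / (b - c)) ^ 2 := by
  set m : ℤ := (n : ℤ) - (j : ℕ) - 1 with hm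
  have hbc : 0 < b - c := sub_pos.mpr hcb
  set S : Finset (Fin n) := {i | i.val < j.val} with hS
  set w : ℝ[X] := ∏ i ∈ S, (X - C (θ i)) with hw
  set ℓ : ℝ[X] := C (2 / (b - c)) * X + C (1 - 2 * b / (b - c)) with hℓ
  have hℓeval : ∀ t, ℓ.eval t = 1 + 2 * (t - b) / (b - c) := fun t => by
    simp only [hℓ, eval_add, eval_mul, eval_C, eval_X]
    ring
  set q : ℝ[X] := (Chebyshev.T ℝ m).comp ℓ with hq
  set τ := (Chebyshev.T ℝ m).eval (1 + 2 * (a - b) / (b - c)) with hτ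
  have hqeval : ∀ t, q.eval t = (Chebyshev.T ℝ m).eval (1 + 2 * (t - b) / (b - c)) := fun t => by
    rw [hq, eval_comp, hℓeval]
  have hτ1 : 1 ≤ τ := by
    refine Chebyshev.one_le_eval_T_real m ?_
    have : 0 ≤ 2 * (a - b) / (b - c) := div_nonneg (by linarith) hbc.le
    linarith
  have hq0 : q ≠ 0 := fun h => by
    have h1 : q.eval a = τ := hqeval a
    rw [h, eval_zero] at h1
    linarith
  have hw0 : w ≠ 0 := (monic_prod_X_sub_C _ _).ne_zero
  have hjn := j.2
  have hdeg : (w * q).natDegree < n := by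
    have hwdeg : w.natDegree = j := by
      rw [hw, natDegree_finsetProd_X_sub_C_eq_card, hS, Fin.card_filter_val_lt]
      omega
    have hqdeg : q.natDegree ≤ m.natAbs := by
      have h1 : q.natDegree ≤ (Chebyshev.T ℝ m).natDegree * ℓ.natDegree := natDegree_comp_le
      rw [Chebyshev.natDegree_T] at h1
      have h2 : ℓ.natDegree ≤ 1 := natDegree_linear_le
      exact h1.trans (mul_le_of_le_one_right (Nat.zero_le _) h2)
    rw [natDegree_mul hw0 hq0]
    omega
  have hweval : ∀ t, w.eval t = ∏ i ∈ S, (t - θ i) := fun t => by simp [hw, eval_prod]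
  have hroot : ∀ i < j, (w * q).IsRoot (θ i) := fun i hi => by
    rw [IsRoot, eval_mul, hweval,
      Finset.prod_eq_zero (show i ∈ S from by simpa [hS] using hi) (sub_self _), zero_mul]
  have hmain := eigenvalue_sub_ritzValue_mul_le hμ hf hB hnN hQ hQX hθanti hs hθ j
    (mul_ne_zero hw0 hq0) hdeg hroot
  rw [← ha] at hmain
  have hθa' : ∀ i ∈ S, a < θ i := fun i hi => hθa i (by simpa [hS] using hi)
  have hwa : w.eval a ^ 2 = (∏ i ∈ S, (θ i - a)) ^ 2 := by
    rw [hweval, ← Finset.prod_pow, ← Finset.prod_pow]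
    exact Finset.prod_congr rfl fun i _ => by ring
  have hac : 0 ≤ a - c := by linarith
  have hsum : ∑ k with (j : ℕ) < (k : Fin N).val, (a - μ k) *
        ((w * q).eval (μ k) ^ 2 * ‖star (f k) ⬝ᵥ v‖ ^ 2) ≤
      (a - c) * ((∏ i ∈ S, (θ i - c)) ^ 2 *
        ∑ k with (j : ℕ) < (k : Fin N).val, ‖star (f k) ⬝ᵥ v‖ ^ 2) := by
    rw [Finset.mul_sum, Finset.mul_sum]
    refine Finset.sum_le_sum fun k hk => ?_
    have hkb : μ k ≤ b := hb k (by simpa using hk)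
    have hck := hc k
    have hq1 : q.eval (μ k) ^ 2 ≤ 1 := by
      rw [hqeval, sq_le_one_iff_abs_le_one]
      refine Chebyshev.abs_eval_T_real_le_one m (abs_le.mpr ⟨?_, ?_⟩)
      · have : -2 ≤ 2 * (μ k - b) / (b - c) := by
          rw [le_div_iff₀ hbc]
          linarith
        linarith
      · have : 2 * (μ k - b) / (b - c) ≤ 0 := div_nonpos_of_nonpos_of_nonneg (by linarith) hbc.le
        linarith
    have hw1 : w.eval (μ k) ^ 2 ≤ (∏ i ∈ S, (θ i - c)) ^ 2 := by
      rw [hweval, ← Finset.prod_pow, ← Finset.prod_pow]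
      refine Finset.prod_le_prod (fun i _ => sq_nonneg _) fun i hi => ?_
      have := hθa' i hi
      nlinarith
    have hwq : (w * q).eval (μ k) ^ 2 ≤ (∏ i ∈ S, (θ i - c)) ^ 2 := by
      rw [eval_mul, mul_pow]
      exact (mul_le_of_le_one_right (sq_nonneg _) hq1).trans hw1
    gcongr
  have hfv : 0 < ‖star (f (Fin.castLE hnN j)) ⬝ᵥ v‖ ^ 2 := by positivity
  have hprod : 0 < (∏ i ∈ S, (θ i - a)) ^ 2 :=
    pow_pos (Finset.prod_pos fun i hi => sub_pos.mpr (hθa' i hi)) 2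
  have hτ2 : 0 < τ ^ 2 := by positivity
  have hfinal := hmain.trans hsum
  rw [eval_mul, mul_pow, hwa, hqeval, ← hτ] at hfinal
  rw [Finset.prod_div_distrib, div_pow, le_div_iff₀ hτ2, div_mul_div_comm, ← mul_div_assoc,
    le_div_iff₀ (mul_pos hprod hfv)]
  linarith

end RayleighRitz

theorem abs_sub_add_sign_mul_sqrt_le {x y t : ℝ} (hxy : y ≠ x) (ht : t ≤ -(x - y) ^ 2) :
    |x - (y + Real.sign (x - y) * √(-t))| ≤ (-(x - y) ^ 2 - t) / (2 * |x - y|) := by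
  have hd : x - y ≠ 0 := sub_ne_zero.mpr hxy.symm
  have hpos : 0 < |x - y| := abs_pos.mpr hd
  have hsq : √(-t) ^ 2 = -t := Real.sq_sqrt (by nlinarith [sq_nonneg (x - y)])
  have hle : |x - y| ≤ √(-t) := Real.abs_le_sqrt (by linarith)
  have habs : |x - (y + Real.sign (x - y) * √(-t))| = √(-t) - |x - y| := by
    rcases hd.lt_or_gt with h | h
    · rw [Real.sign_of_neg h, abs_of_neg h] at *
      rw [abs_of_nonneg (by linarith)]
      ring
    · rw [Real.sign_of_pos h, abs_of_pos h] at *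
      rw [abs_of_nonpos (by linarith)]
      ring
  rw [habs, le_div_iff₀ (by positivity), ← sq_abs (x - y)]
  nlinarith [sq_nonneg (√(-t) - |x - y|)]

/-- **Interior eigenvalue bound.**  Let `λ_α` be an eigenvalue of the Hermitian matrix
`A` with `Λ ≠ λ_α`, and let `A' = −(Λ·I − A)²`, with eigenvalues `lam'` in decreasing
order and orthonormal eigenvectors `z'`, and let `j` (zero-based) be an index with
`λ'_j = −(λ_α − Λ)²`.  Assume `K(A',v,n)` has dimension `n`, `⟨z'_j, v⟩ ≠ 0`,
`λ'_{j+1} > λ'_N`, and `θ'_i > λ'_j` for all `i < j`, where `θ'` are the Ritz values of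
`A'` from `K(A',v,n)`.  With `θ̄_α = Λ + sgn(λ_α − Λ)·√(−θ'_j)`,
`|λ_α − θ̄_α| ≤ (λ'_j − λ'_N)·(K'_j·tan∠'_j)² / (2|λ_α − Λ|·T_{n−j}(γ'_j(λ'_j))²)`. -/
theorem interior_eigenvalue_bound {N n : ℕ}
    (A : Matrix (Fin N) (Fin N) ℂ) (hA : A.IsHermitian)
    (lam : Fin N → ℝ) (hlam : Antitone lam)
    (z : Fin N → (Fin N → ℂ))
    (hz : ∀ i k, star (z i) ⬝ᵥ z k = if i = k then 1 else 0)
    (hAz : ∀ i, A.mulVec (z i) = (lam i : ℂ) • z i)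
    (Λ : ℝ)
    (lam' : Fin N → ℝ) (hlam' : Antitone lam')
    (z' : Fin N → (Fin N → ℂ))
    (hz' : ∀ i k, star (z' i) ⬝ᵥ z' k = if i = k then 1 else 0)
    (hA'z : ∀ i, (-((Λ : ℂ) • (1 : Matrix (Fin N) (Fin N) ℂ) - A) ^ 2).mulVec (z' i) =
      (lam' i : ℂ) • z' i)
    (v : Fin N → ℂ) (hv : v ≠ 0) (hn : 1 ≤ n)
    (hK : Module.finrank ℂ
      (Krylov (-((Λ : ℂ) • (1 : Matrix (Fin N) (Fin N) ℂ) - A) ^ 2) v n) = n)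
    (hnN : n ≤ N)
    (Q : Matrix (Fin N) (Fin n) ℂ) (hQ : Qᴴ * Q = 1)
    (hQX : LinearMap.range Q.mulVecLin =
      Krylov (-((Λ : ℂ) • (1 : Matrix (Fin N) (Fin N) ℂ) - A) ^ 2) v n)
    (θ' : Fin n → ℝ) (hθ' : Antitone θ')
    (s : Fin n → (Fin n → ℂ))
    (hs : ∀ i k, star (s i) ⬝ᵥ s k = if i = k then 1 else 0)
    (hθ's : ∀ i, (Qᴴ * (-((Λ : ℂ) • (1 : Matrix (Fin N) (Fin N) ℂ) - A) ^ 2) * Q).mulVec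
      (s i) = (θ' i : ℂ) • s i)
    (α : Fin N) (hΛα : Λ ≠ lam α)
    (j : Fin n) (hjN : (j : ℕ) + 1 < N)
    (hj : lam' (Fin.castLE hnN j) = -(lam α - Λ) ^ 2)
    (hzv : star (z' (Fin.castLE hnN j)) ⬝ᵥ v ≠ 0)
    (hgap : lam' ⟨(j : ℕ) + 1, hjN⟩ > lam' ⟨N - 1, by omega⟩)
    (hθi : ∀ i : Fin n, (i : ℕ) < (j : ℕ) → θ' i > lam' (Fin.castLE hnN j)) :
    |lam α - (Λ + Real.sign (lam α - Λ) * Real.sqrt (-θ' j))| ≤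
      (lam' (Fin.castLE hnN j) - lam' ⟨N - 1, by omega⟩) *
        ((∏ i ∈ Finset.univ.filter fun i : Fin n => (i : ℕ) < (j : ℕ),
            (θ' i - lam' ⟨N - 1, by omega⟩) / (θ' i - lam' (Fin.castLE hnN j))) ^ 2 *
          ((∑ k ∈ Finset.univ.filter fun k : Fin N => (j : ℕ) < (k : ℕ),
              ‖star (z' k) ⬝ᵥ v‖ ^ 2) / ‖star (z' (Fin.castLE hnN j)) ⬝ᵥ v‖ ^ 2)) /
        (2 * |lam α - Λ| *
          ((Polynomial.Chebyshev.T ℝ ((n : ℤ) - (j : ℕ) - 1)).eval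
            (1 + 2 * (lam' (Fin.castLE hnN j) - lam' ⟨(j : ℕ) + 1, hjN⟩) /
              (lam' ⟨(j : ℕ) + 1, hjN⟩ - lam' ⟨N - 1, by omega⟩))) ^ 2) := by
  have hbound := eigenvalue_sub_ritzValue_le hlam' hz' hA'z hnN hQ hQX hθ' hs hθ's j rfl
    (hlam' (show Fin.castLE hnN j ≤ ⟨(j : ℕ) + 1, hjN⟩ from Nat.le_succ _)) hgap
    (fun k hk => hlam' (show (⟨(j : ℕ) + 1, hjN⟩ : Fin N) ≤ k from hk))
    (fun k => hlam' (show k ≤ (⟨N - 1, by omega⟩ : Fin N) from Nat.le_sub_one_of_lt k.2)) hzv hθi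
  have hle := ritzValue_le_eigenvalue hlam' hz' hA'z hnN hQ hθ' hs hθ's j
  refine (abs_sub_add_sign_mul_sqrt_le hΛα (hle.trans_eq hj)).trans ?_
  rw [← hj, mul_comm (2 * |lam α - Λ|) (_ ^ 2), ← div_div _ (_ ^ 2)]
  exact div_le_div_of_nonneg_right hbound (mul_nonneg zero_le_two (abs_nonneg _))
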